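/- For any instance (F_1^*,…,F_m^*;k^*) obtained by the m-BR-process on an instance (F_1,…,F_m;k) of the hMaf problem, Ord(F_1^*) ≥ |S_B| + Ord_max(F_1,…,F_m;k), where S_B is the set of edges removed by Branching Rule 1 during the m-BR-process from (F_1,…,F_m;k) to (F_1^*,…,F_m^*;k^*). -/

import Mathlib

/-!
A formalization framework for the Maximum Agreement Forest problem on multiple
rooted multifurcating phylogenetic trees.

An `X`-forest is modeled (up to forced contraction and label-preserving
isomorphism) by the laminar family of the label-sets `L(v)` of its vertices:
every vertex `v` is identified with the set `L(v)` of labels at its leaf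
descendants, components correspond to the maximal clusters, leaves to the
singleton clusters, and the edge between a non-root vertex `v` and its parent
is identified with the cluster `L(v)`.
-/

open Finset

noncomputable section
open scoped Classical

/-- A rooted multifurcating phylogenetic `X`-forest, described by the laminar
family of the label sets of its vertices. -/
structure XForest (X : Type*) where
  clusters : Finset (Finset X)
  nonempty_of_mem : ∀ s ∈ clusters, s.Nonempty
  laminar : ∀ s ∈ clusters, ∀ t ∈ clusters, ¬Disjoint s t → s ⊆ t ∨ t ⊆ s
  singleton_mem : ∀ x : X, {x} ∈ clusters

namespace XForest

variable {X : Type*} [DecidableEq X] [Fintype X]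

/-- The connected components of an `X`-forest: the maximal clusters.  The
component `C` is identified with its label set `L(C)`. -/
def components (F : XForest X) : Finset (Finset X) :=
  F.clusters.filter fun s => ∀ t ∈ F.clusters, ¬s ⊂ t

/-- The order of an `X`-forest: its number of connected components. -/
def ord (F : XForest X) : ℕ := F.components.card

/-- `c` is (the cluster of) a child of (the vertex with cluster) `p`. -/
def IsChild (F : XForest X) (c p : Finset X) : Prop :=
  c ∈ F.clusters ∧ p ∈ F.clusters ∧ c ⊂ p ∧ ∀ t ∈ F.clusters, c ⊂ t → ¬t ⊂ p

/-- The family obtained from the laminar family `A` by removing, for every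
`d ∈ D`, the edge between the vertex with cluster `d` and its parent. -/
def cutFam (A D : Finset (Finset X)) : Finset (Finset X) :=
  (A.image fun s => s \ (D.filter fun d => d ⊂ s).biUnion id).filter fun s => s.Nonempty

/-- The `X`-forest obtained from `F` by removing the edges above the clusters
in `D` (followed by forced contraction). -/
def cut (F : XForest X) (D : Finset (Finset X)) : XForest X where
  clusters := cutFam F.clusters (D.filter fun d => d ∈ F.clusters)
  nonempty_of_mem := fun s hs => (Finset.mem_filter.mp hs).2
  laminar := by
    intro s' hs' t' ht' hnd
    set D' : Finset (Finset X) := D.filter fun d => d ∈ F.clusters with hD'def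
    have hD'sub : ∀ d ∈ D', d ∈ F.clusters := fun d hd => (Finset.mem_filter.mp hd).2
    obtain ⟨hs'm, -⟩ := Finset.mem_filter.mp hs'
    obtain ⟨s, hs, rfl⟩ := Finset.mem_image.mp hs'm
    obtain ⟨ht'm, -⟩ := Finset.mem_filter.mp ht'
    obtain ⟨t, ht, rfl⟩ := Finset.mem_image.mp ht'm
    obtain ⟨x, hxs, hxt⟩ := Finset.not_disjoint_iff.mp hnd
    have key : ∀ u ∈ F.clusters, ∀ w ∈ F.clusters, u ⊆ w →
        ∀ z, z ∈ u \ (D'.filter fun d => d ⊂ u).biUnion id →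
          z ∈ w \ (D'.filter fun d => d ⊂ w).biUnion id →
          u \ (D'.filter fun d => d ⊂ u).biUnion id ⊆
            w \ (D'.filter fun d => d ⊂ w).biUnion id := by
      intro u hu w hw huw z hzu hzw y hy
      rw [Finset.mem_sdiff] at hy hzu hzw ⊢
      refine ⟨huw hy.1, ?_⟩
      intro hyU
      rw [Finset.mem_biUnion] at hyU
      obtain ⟨d, hd, hyd⟩ := hyU
      rw [Finset.mem_filter] at hd
      have hdF : d ∈ F.clusters := hD'sub d hd.1
      have hdw : d ⊂ w := hd.2
      have hlam := F.laminar d hdF u hu (Finset.not_disjoint_iff.mpr ⟨y, hyd, hy.1⟩)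
      rcases hlam with hdu | hud
      · by_cases hde : d = u
        · exact hzw.2 (Finset.mem_biUnion.mpr
            ⟨d, Finset.mem_filter.mpr ⟨hd.1, hdw⟩, hde ▸ hzu.1⟩)
        · have hss : d ⊂ u := Finset.ssubset_iff_subset_ne.mpr ⟨hdu, hde⟩
          exact hy.2 (Finset.mem_biUnion.mpr
            ⟨d, Finset.mem_filter.mpr ⟨hd.1, hss⟩, hyd⟩)
      · exact hzw.2 (Finset.mem_biUnion.mpr
          ⟨d, Finset.mem_filter.mpr ⟨hd.1, hdw⟩, hud hzu.1⟩)
    have hxs' : x ∈ s ∧ x ∈ t := by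
      constructor
      · exact (Finset.mem_sdiff.mp hxs).1
      · exact (Finset.mem_sdiff.mp hxt).1
    rcases F.laminar s hs t ht (Finset.not_disjoint_iff.mpr ⟨x, hxs'.1, hxs'.2⟩) with hst | hts
    · exact Or.inl (key s hs t ht hst x hxs hxt)
    · exact Or.inr (key t ht s hs hts x hxt hxs)
  singleton_mem := by
    intro x
    have hU : ((D.filter fun d => d ∈ F.clusters).filter fun d => d ⊂ ({x} : Finset X)) = ∅ := by
      rw [Finset.filter_eq_empty_iff]
      intro d hd hss
      have hne := F.nonempty_of_mem d (Finset.mem_filter.mp hd).2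
      rw [Finset.ssubset_singleton_iff.mp hss] at hne
      exact Finset.not_nonempty_empty hne
    refine Finset.mem_filter.mpr ⟨?_, Finset.singleton_nonempty x⟩
    refine Finset.mem_image.mpr ⟨{x}, F.singleton_mem x, ?_⟩
    rw [hU]
    simp

/-- `G` is a subforest of `F` (up to forced contraction and label-preserving
isomorphism): `G` is obtained from `F` by removing a set of edges. -/
def IsSubforest (G F : XForest X) : Prop :=
  ∃ D ⊆ F.clusters, G.clusters = (F.cut D).clusters

/-- The edge of `F` between the vertex with cluster `c` and its parent is *in*
the forest `G` (i.e. it lies on a path of `F` connecting two labels that belong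
to a common connected component of `G`). -/
def EdgeUsed (F : XForest X) (c : Finset X) (G : XForest X) : Prop :=
  ∃ x ∈ c, ∃ y, y ∉ c ∧ (∃ C ∈ F.components, x ∈ C ∧ y ∈ C) ∧
    ∃ D ∈ G.components, x ∈ D ∧ y ∈ D

/-- The least common ancestor of the two labels `a` and `b` in `F` (given as
its cluster, i.e. as the label set `L(lca_F(a,b))`). -/
def lca2 (F : XForest X) (a b : X) : Finset X :=
  (F.clusters.filter fun s => a ∈ s ∧ b ∈ s).inf id

/-- The least common ancestor of the labels of `S` in `F` (given as its
cluster). -/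
def lcaS (F : XForest X) (S : Finset X) : Finset X :=
  (F.clusters.filter fun s => S ⊆ s).inf id

/-- `E^1_F(a,b)`: the edges of `F` that are not on the path `P` connecting the
labels `a` and `b` but are incident to internal vertices of this path other
than `lca_F(a,b)` (each edge is identified with the cluster of its lower
endpoint). -/
def E1 (F : XForest X) (a b : X) : Finset (Finset X) :=
  F.clusters.filter fun d => ∃ c ∈ F.clusters, F.IsChild d c ∧ c ⊂ F.lca2 a b ∧
    ((a ∈ c ∧ c ≠ {a} ∧ a ∉ d) ∨ (b ∈ c ∧ c ≠ {b} ∧ b ∉ d))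

/-- `E^2_F(a,b)`: the edges incident to `lca_F(a,b)` other than the two edges
on the path connecting `a` and `b` and the edge to the parent of the lca. -/
def E2 (F : XForest X) (a b : X) : Finset (Finset X) :=
  F.clusters.filter fun d => F.IsChild d (F.lca2 a b) ∧ a ∉ d ∧ b ∉ d

/-- `E_F(a,b) = E^1_F(a,b) ∪ E^2_F(a,b)`. -/
def Eset (F : XForest X) (a b : X) : Finset (Finset X) := F.E1 a b ∪ F.E2 a b

/-- `E^O_F(S)`: the edges between `lca_F(S)` and its children that are not
labels in `S`. -/
def EO (F : XForest X) (S : Finset X) : Finset (Finset X) :=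
  F.clusters.filter fun d => F.IsChild d (F.lcaS S) ∧ ∀ x ∈ S, d ≠ {x}

/-- `S` is a maximal sibling set (MSS) of `F`: the leaves with labels in `S`
have a common parent `p` whose children are exactly the labels in `S`
(equivalently, `S` itself is a cluster all of whose proper subclusters are
singletons). -/
def IsMSS (F : XForest X) (S : Finset X) : Prop :=
  S ∈ F.clusters ∧ 2 ≤ S.card ∧ ∀ c ∈ F.clusters, c ⊂ S → c.card = 1

/-- the labels in `S` are (pairwise) siblings in `F`, i.e., they have a common
parent. -/
def Siblings (F : XForest X) (S : Finset X) : Prop :=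
  ∃ p ∈ F.clusters, ∀ x ∈ S, F.IsChild {x} p

/-- An `X`-forest is binary if each of its non-leaf vertices has exactly two
children. -/
def IsBinary (F : XForest X) : Prop :=
  ∀ s ∈ F.clusters, 2 ≤ s.card → ∃ c₁ c₂ : Finset X, c₁ ≠ c₂ ∧
    F.IsChild c₁ s ∧ F.IsChild c₂ s ∧ ∀ c, F.IsChild c s → c = c₁ ∨ c = c₂

/-- `B` is a resolution of `F`: `F` can be obtained from `B` by contracting
internal edges. -/
def IsResolution (B F : XForest X) : Prop :=
  F.clusters ⊆ B.clusters ∧ B.components = F.components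

/-- `G` is a binary subforest of `F`: `G` is binary and is a subforest of some
binary resolution of `F`. -/
def IsBinarySubforest (G F : XForest X) : Prop :=
  G.IsBinary ∧ ∃ B : XForest X, B.IsBinary ∧ IsResolution B F ∧ IsSubforest G B

end XForest

variable {X : Type*} [DecidableEq X] [Fintype X] {m : ℕ}

/-- A hard agreement forest for the `X`-forests `Fs`. -/
def IsHAF (Fs : Fin m → XForest X) (G : XForest X) : Prop :=
  ∀ i, XForest.IsSubforest G (Fs i)

/-- A hard maximum agreement forest (hMAF) for the `X`-forests `Fs`. -/
def IsHMAF (Fs : Fin m → XForest X) (G : XForest X) : Prop :=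
  IsHAF Fs G ∧ ∀ G', IsHAF Fs G' → G.ord ≤ G'.ord

/-- A soft agreement forest for the `X`-forests `Fs`. -/
def IsSAF (Fs : Fin m → XForest X) (G : XForest X) : Prop :=
  ∀ i, XForest.IsBinarySubforest G (Fs i)

/-- A soft maximum agreement forest (sMAF) for the `X`-forests `Fs`. -/
def IsSMAF (Fs : Fin m → XForest X) (G : XForest X) : Prop :=
  IsSAF Fs G ∧ ∀ G', IsSAF Fs G' → G.ord ≤ G'.ord

/-- An instance `(F_1, …, F_m; k)` of the (hard or soft) Maf problem. -/
structure Inst (X : Type*) (m : ℕ) where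
  F : Fin m → XForest X
  k : ℤ

namespace Inst

/-- the largest order of an `X`-forest in the instance. -/
def ordMax (I : Inst X m) : ℕ := Finset.univ.sup fun i => (I.F i).ord

/-- a solution of an instance of the hMaf problem: a hard agreement forest
whose order is at most `ordMax + k`. -/
def IsSolution (I : Inst X m) (G : XForest X) : Prop :=
  IsHAF I.F G ∧ (G.ord : ℤ) ≤ (I.ordMax : ℤ) + I.k

/-- a yes-instance of the hMaf problem. -/
def IsYes (I : Inst X m) : Prop := ∃ G, I.IsSolution G

/-- a solution of an instance of the sMaf problem. -/
def IsSSolution (I : Inst X m) (G : XForest X) : Prop :=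
  IsSAF I.F G ∧ (G.ord : ℤ) ≤ (I.ordMax : ℤ) + I.k

/-- a yes-instance of the sMaf problem. -/
def IsSYes (I : Inst X m) : Prop := ∃ G, I.IsSSolution G

/-- `S` is a minimum maximal sibling set of the instance `I`, lying in the
`i`-th forest. -/
def MinMSS (I : Inst X m) (i : Fin m) (S : Finset X) : Prop :=
  (I.F i).IsMSS S ∧ ∀ j : Fin m, ∀ S' : Finset X, (I.F j).IsMSS S' → S.card ≤ S'.card

end Inst

/-- the new value of the parameter after removing one edge from the `j`-th
forest (the maximum order `ordMax + k` stays invariant). -/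
def cutk (I : Inst X m) (j : Fin m) : ℤ :=
  if (I.F j).ord = I.ordMax then I.k - 1 else I.k

/-- Reduction Rule 1 is applicable on `Fj` relative to `Fi`, at the vertex `v`
of `Fj` (whose parent edge is to be removed): there is a subset
`{C_1, …, C_t}` (`t ≥ 1`) of the components of `Fi` and a component `C` of
`Fj` containing a non-root vertex `v` with
`L(v) = L(C) ∩ (L(C_1) ∪ … ∪ L(C_t))`. -/
def RR1App (Fi Fj : XForest X) (v : Finset X) : Prop :=
  ∃ 𝒞 ⊆ Fi.components, 𝒞.Nonempty ∧
    ∃ C ∈ Fj.components, v ∈ Fj.clusters ∧ v ⊆ C ∧ (∃ t ∈ Fj.clusters, v ⊂ t) ∧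
      v = C ∩ 𝒞.biUnion id

/-- One application of Reduction Rule 1 to the instance `I`, producing `I'`. -/
def RR1Step (I I' : Inst X m) : Prop :=
  ∃ i j, i ≠ j ∧ ∃ v, RR1App (I.F i) (I.F j) v ∧
    I' = ⟨Function.update I.F j ((I.F j).cut {v}), cutk I j⟩

/-- Reduction Rule 1 is applicable somewhere on the instance `I`. -/
def RR1Applicable (I : Inst X m) : Prop :=
  ∃ i j, i ≠ j ∧ ∃ v, RR1App (I.F i) (I.F j) v

/-- `I'` is obtained from `I` by applying Reduction Rule 1 repeatedly until it
is no longer applicable. -/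
def RR1Exhaust (I I' : Inst X m) : Prop :=
  Relation.ReflTransGen RR1Step I I' ∧ ¬RR1Applicable I'

/-- The situation of Case 1 (Branching Rule 1) for `Fj` relative to `Fi`:
there is a component `C` of `Fi` and a vertex `v` of `Fj` with two children
`c₁, c₂` such that `L(c₁) ⊆ L(C)` and `L(c₂) ∩ L(C) = ∅`. -/
def BR1AppCore (Fi Fj : XForest X) (v c₁ c₂ : Finset X) : Prop :=
  ∃ C ∈ Fi.components, Fj.IsChild c₁ v ∧ Fj.IsChild c₂ v ∧ c₁ ≠ c₂ ∧
    c₁ ⊆ C ∧ c₂ ∩ C = ∅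

/-- An application of Branching Rule 1 to the instance `I` (on the forest with
index `j`, relative to the forest with index `i`), branching into the two
instances `I₁` (removing `[v,c₁]`) and `I₂` (removing `[v,c₂]`). -/
def BR1Branch (I : Inst X m) (i j : Fin m) (v c₁ c₂ : Finset X)
    (I₁ I₂ : Inst X m) : Prop :=
  i ≠ j ∧ BR1AppCore (I.F i) (I.F j) v c₁ c₂ ∧
    I₁ = ⟨Function.update I.F j ((I.F j).cut {c₁}), cutk I j⟩ ∧
    I₂ = ⟨Function.update I.F j ((I.F j).cut {c₂}), cutk I j⟩

/-- two `X`-forests satisfy the label-set isomorphism property. -/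
def LabelIso (F F' : XForest X) : Prop := F.components = F'.components

/-- an instance satisfies the label-set isomorphism property. -/
def InstLabelIso (I : Inst X m) : Prop := ∀ i j, LabelIso (I.F i) (I.F j)

/-- One computation path of the 2-BR-process on the forests with indices `p`
and `q`: repeatedly apply Branching Rule 1 between these two forests (choosing
one of the two branches) followed by an exhaustive application of Reduction
Rule 1, until the two forests satisfy the label-set isomorphism property.  The
natural number records the number of edges removed by Branching Rule 1 along
the path. -/
inductive TwoBRPath {X : Type*} [DecidableEq X] [Fintype X] {m : ℕ} (p q : Fin m) :
    Inst X m → Inst X m → ℕ → Prop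
  | done (I : Inst X m) (h : LabelIso (I.F p) (I.F q)) : TwoBRPath p q I I 0
  | step {I I₁ I₂ J K I' : Inst X m} {n : ℕ} {i j : Fin m} {v c₁ c₂ : Finset X}
      (hij : (i = p ∧ j = q) ∨ (i = q ∧ j = p))
      (hbr : BR1Branch I i j v c₁ c₂ I₁ I₂)
      (hpick : J = I₁ ∨ J = I₂)
      (hex : RR1Exhaust J K)
      (hrest : TwoBRPath p q K I' n) : TwoBRPath p q I I' (n + 1)

/-- `s` and `t` are the indices of two forests with the first and the second
largest orders in `I`. -/
def FirstSecond (I : Inst X m) (s t : Fin m) : Prop :=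
  s ≠ t ∧ (∀ i, (I.F i).ord ≤ (I.F s).ord) ∧ ∀ i, i ≠ s → (I.F i).ord ≤ (I.F t).ord

/-- One computation path of Stage 2 of the m-BR-process: repeatedly apply the
2-BR-process to two forests with first and second largest orders not
satisfying the label-set isomorphism property, until the whole instance
satisfies the label-set isomorphism property. -/
inductive MBRAux {X : Type*} [DecidableEq X] [Fintype X] {m : ℕ} :
    Inst X m → Inst X m → ℕ → Prop
  | done (I : Inst X m) (h : InstLabelIso I) : MBRAux I I 0
  | step {I J I' : Inst X m} {a b : ℕ} {s t : Fin m}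
      (hst : FirstSecond I s t) (hni : ¬LabelIso (I.F s) (I.F t))
      (h2 : TwoBRPath s t I J a) (hrest : MBRAux J I' b) : MBRAux I I' (a + b)

/-- One computation path of the m-BR-process on the instance `I`, ending at
the instance `I'`, along which `n` edges are removed by Branching Rule 1. -/
def MBRPath (I I' : Inst X m) (n : ℕ) : Prop :=
  ∃ J, RR1Exhaust I J ∧ MBRAux J I' n

/-- The full branching tree of the 2-BR-process on the forests with indices
`p` and `q`, producing the collection (list) of resulting instances, each
together with the number of edges removed by Branching Rule 1 on its
computation path. -/
inductive TwoBRTree {X : Type*} [DecidableEq X] [Fintype X] {m : ℕ} (p q : Fin m) :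
    Inst X m → List (Inst X m × ℕ) → Prop
  | done (I : Inst X m) (h : LabelIso (I.F p) (I.F q)) : TwoBRTree p q I [(I, 0)]
  | step {I I₁ I₂ K₁ K₂ : Inst X m} {L₁ L₂ : List (Inst X m × ℕ)}
      {i j : Fin m} {v c₁ c₂ : Finset X}
      (hij : (i = p ∧ j = q) ∨ (i = q ∧ j = p))
      (hbr : BR1Branch I i j v c₁ c₂ I₁ I₂)
      (he₁ : RR1Exhaust I₁ K₁) (he₂ : RR1Exhaust I₂ K₂)
      (h₁ : TwoBRTree p q K₁ L₁) (h₂ : TwoBRTree p q K₂ L₂) :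
      TwoBRTree p q I ((L₁ ++ L₂).map fun x => (x.1, x.2 + 1))

/-- One step of Stage 2 of the m-BR-process on a collection of instances:
replace an instance, in which two forests of first and second largest orders
do not satisfy the label-set isomorphism property, by the collection produced
by the 2-BR-process on those two forests. -/
inductive CollStep {X : Type*} [DecidableEq X] [Fintype X] {m : ℕ} :
    List (Inst X m × ℕ) → List (Inst X m × ℕ) → Prop
  | step {I : Inst X m} {n : ℕ} {A B L : List (Inst X m × ℕ)} {s t : Fin m}
      (hst : FirstSecond I s t) (hni : ¬LabelIso (I.F s) (I.F t))
      (h : TwoBRTree s t I L) :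
      CollStep (A ++ (I, n) :: B) (A ++ L.map (fun y => (y.1, y.2 + n)) ++ B)

/-- The m-BR-process on the instance `I` produces the collection `L` of
instances (each recorded with the number of edges removed by Branching Rule 1
on the path leading to it): Stage 1 applies Reduction Rule 1 exhaustively, and
Stage 2 repeatedly applies the 2-BR-process until every instance of the
collection satisfies the label-set isomorphism property. -/
def MBRTree (I : Inst X m) (L : List (Inst X m × ℕ)) : Prop :=
  ∃ J, RR1Exhaust I J ∧ Relation.ReflTransGen CollStep [(J, 0)] L ∧
    ∀ x ∈ L, InstLabelIso x.1

/-- The 2-edge distance property of an instance. -/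
def TwoEdgeDist (I : Inst X m) : Prop :=
  ∃ (G : Inst X m) (E : Fin m → Finset (Finset X)),
    InstLabelIso G ∧ G.k = I.k + 1 ∧
    (∀ i, E i ⊆ (G.F i).clusters) ∧ (∀ i, (E i).card ≤ 1) ∧
    (∀ i, ∀ v ∈ E i, ∃ t ∈ (G.F i).clusters, v ⊂ t) ∧
    (∀ i, (I.F i).clusters = ((G.F i).cut (E i)).clusters) ∧
    ∃ i j : Fin m, i < j ∧ ∃ vi ∈ E i, ∃ vj ∈ E j, vi ≠ vj

/-- A branching step producing instances with parameters `ks` from an instance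
with parameter `k` satisfies the recurrence relation
`T(k) ≤ c₁·T(k-1) + c₂·T(k-2)`:  for every nonnegative monotone `T` satisfying
the recurrence, the sum of the `T`-values of the produced parameters is at
most `T k`. -/
def RecBound (k : ℤ) (ks : List ℤ) (c₁ c₂ : ℕ) : Prop :=
  ∀ T : ℤ → ℝ, (∀ x, 0 ≤ T x) → Monotone T →
    (∀ x : ℤ, (c₁ : ℝ) * T (x - 1) + (c₂ : ℝ) * T (x - 2) ≤ T x) →
    (ks.map T).sum ≤ T k

end

section Helpers
open scoped Classical

variable {X : Type*} [DecidableEq X] [Fintype X] {m : ℕ}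

theorem XForest.mem_cut_single (F : XForest X) {v : Finset X} (hv : v ∈ F.clusters)
    (u : Finset X) : u ∈ (F.cut {v}).clusters ↔
      ∃ s ∈ F.clusters, (v ⊂ s ∧ u = s \ v) ∨ (¬ v ⊂ s ∧ u = s) := by
  have hD : (({v} : Finset (Finset X)).filter fun d => d ∈ F.clusters) = {v} := by
    ext d
    simp only [Finset.mem_filter, Finset.mem_singleton]
    constructor
    · exact fun h => h.1
    · rintro rfl
      exact ⟨rfl, hv⟩
  have h1 : ∀ s : Finset X, v ⊂ s →
      (({v} : Finset (Finset X)).filter fun d => d ⊂ s).biUnion id = v := by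
    intro s hs
    rw [Finset.filter_singleton, if_pos hs]
    simp
  have h2 : ∀ s : Finset X, ¬ v ⊂ s →
      (({v} : Finset (Finset X)).filter fun d => d ⊂ s).biUnion id = ∅ := by
    intro s hs
    rw [Finset.filter_singleton, if_neg hs]
    simp
  change u ∈ XForest.cutFam F.clusters _ ↔ _
  rw [hD]
  unfold XForest.cutFam
  rw [Finset.mem_filter, Finset.mem_image]
  constructor
  · rintro ⟨⟨s, hs, rfl⟩, -⟩
    refine ⟨s, hs, ?_⟩
    by_cases h : v ⊂ s
    · left; exact ⟨h, by rw [h1 s h]⟩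
    · right; exact ⟨h, by rw [h2 s h, Finset.sdiff_empty]⟩
  · rintro ⟨s, hs, ⟨h, rfl⟩ | ⟨h, rfl⟩⟩
    · refine ⟨⟨s, hs, by rw [h1 s h]⟩, ?_⟩
      rw [Finset.sdiff_nonempty]
      exact h.2
    · exact ⟨⟨u, hs, by rw [h2 u h, Finset.sdiff_empty]⟩, F.nonempty_of_mem u hs⟩

theorem XForest.exists_component (F : XForest X) {s : Finset X} (hs : s ∈ F.clusters) :
    ∃ C ∈ F.components, s ⊆ C := by
  obtain ⟨C, hsC, hC⟩ := F.clusters.exists_le_maximal hs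
  refine ⟨C, Finset.mem_filter.mpr ⟨hC.prop, fun t ht h => ?_⟩, hsC⟩
  exact h.2 (hC.le_of_ge ht h.1)

theorem XForest.comp_mem (F : XForest X) {C : Finset X} (hC : C ∈ F.components) :
    C ∈ F.clusters := (Finset.mem_filter.mp hC).1

/-- A cluster meeting a component is contained in it. -/
theorem XForest.sub_comp (F : XForest X) {C s : Finset X} (hC : C ∈ F.components)
    (hs : s ∈ F.clusters) (h : ¬ Disjoint s C) : s ⊆ C := by
  rcases F.laminar s hs C (F.comp_mem hC) h with h | h
  · exact h
  · by_contra hn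
    exact (Finset.mem_filter.mp hC).2 s hs ⟨h, hn⟩

theorem XForest.comp_eq (F : XForest X) {C D : Finset X} (hC : C ∈ F.components)
    (hD : D ∈ F.components) (h : ¬ Disjoint C D) : C = D :=
  Finset.Subset.antisymm (F.sub_comp hD (F.comp_mem hC) h)
    (F.sub_comp hC (F.comp_mem hD) (fun h' => h h'.symm))

theorem XForest.exists_comp_mem (F : XForest X) (x : X) : ∃ C ∈ F.components, x ∈ C := by
  obtain ⟨C, hC, h⟩ := F.exists_component (F.singleton_mem x)
  exact ⟨C, hC, h (Finset.mem_singleton_self x)⟩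

theorem XForest.components_cut (F : XForest X) {v D : Finset X} (hv : v ∈ F.clusters)
    (hD : D ∈ F.components) (hvD : v ⊂ D) :
    (F.cut {v}).components = insert v (insert (D \ v) (F.components.erase D)) := by
  have hDc := F.comp_mem hD
  have hvne := F.nonempty_of_mem v hv
  have hvcut : v ∈ (F.cut {v}).clusters :=
    (F.mem_cut_single hv v).mpr ⟨v, hv, Or.inr ⟨fun h => h.2 h.1, rfl⟩⟩
  have hDcut : D \ v ∈ (F.cut {v}).clusters :=
    (F.mem_cut_single hv _).mpr ⟨D, hDc, Or.inl ⟨hvD, rfl⟩⟩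
  have hDne : (D \ v).Nonempty := by rw [Finset.sdiff_nonempty]; exact hvD.2
  have hsD : ∀ s ∈ F.clusters, v ⊆ s → s ⊆ D := by
    intro s hs h
    obtain ⟨x, hx⟩ := hvne
    exact F.sub_comp hD hs (Finset.not_disjoint_iff.mpr ⟨x, h hx, hvD.1 hx⟩)
  have hEcut : ∀ E ∈ F.components, E ≠ D → E ∈ (F.cut {v}).clusters := by
    intro E hE hne
    refine (F.mem_cut_single hv _).mpr ⟨E, F.comp_mem hE, Or.inr ⟨fun h => ?_, rfl⟩⟩
    obtain ⟨x, hx⟩ := hvne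
    exact hne (F.comp_eq hE hD (Finset.not_disjoint_iff.mpr ⟨x, h.1 hx, hvD.1 hx⟩))
  ext u
  simp only [Finset.mem_insert, Finset.mem_erase]
  constructor
  · intro hu
    obtain ⟨huc, hmax⟩ := Finset.mem_filter.mp hu
    have hle : ∀ t ∈ (F.cut {v}).clusters, u ⊆ t → u = t := by
      intro t ht h
      by_contra hne
      exact hmax t ht (Finset.ssubset_iff_subset_ne.mpr ⟨h, hne⟩)
    obtain ⟨s, hs, ⟨hvs, rfl⟩ | ⟨hvs, rfl⟩⟩ := (F.mem_cut_single hv u).mp huc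
    · right; left
      exact hle _ hDcut (Finset.sdiff_subset_sdiff (hsD s hs hvs.1) (Finset.Subset.refl _))
    · by_cases hdis : Disjoint u v
      · obtain ⟨E, hE, huE⟩ := F.exists_component hs
        by_cases hED : E = D
        · right; left
          apply hle _ hDcut
          intro x hx
          exact Finset.mem_sdiff.mpr ⟨hED ▸ huE hx, Finset.disjoint_left.mp hdis hx⟩
        · right; right
          have := hle _ (hEcut E hE hED) huE
          subst this
          exact ⟨hED, hE⟩
      · left
        rcases F.laminar u hs v hv hdis with h | h
        · exact hle _ hvcut h
        · by_contra hne
          exact hvs (Finset.ssubset_iff_subset_ne.mpr ⟨h, fun h => hne h.symm⟩)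
  · rintro (rfl | rfl | ⟨hne, hE⟩)
    · refine Finset.mem_filter.mpr ⟨hvcut, fun t ht hlt => ?_⟩
      obtain ⟨s, hs, ⟨hvs, rfl⟩ | ⟨hvs, rfl⟩⟩ := (F.mem_cut_single hv t).mp ht
      · obtain ⟨x, hx⟩ := hvne
        exact (Finset.mem_sdiff.mp (hlt.1 hx)).2 hx
      · exact hvs hlt
    · refine Finset.mem_filter.mpr ⟨hDcut, fun t ht hlt => ?_⟩
      obtain ⟨s, hs, ⟨hvs, rfl⟩ | ⟨hvs, rfl⟩⟩ := (F.mem_cut_single hv t).mp ht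
      · exact hlt.2 (Finset.sdiff_subset_sdiff (hsD s hs hvs.1) (Finset.Subset.refl _))
      · obtain ⟨y, hy⟩ := hDne
        have htD : t ⊆ D := F.sub_comp hD hs
          (Finset.not_disjoint_iff.mpr ⟨y, hlt.1 hy, (Finset.mem_sdiff.mp hy).1⟩)
        obtain ⟨x, hxt, hx⟩ := Finset.not_subset.mp hlt.2
        have hxv : x ∈ v := by
          by_contra hxv
          exact hx (Finset.mem_sdiff.mpr ⟨htD hxt, hxv⟩)
        rcases F.laminar t hs v hv (Finset.not_disjoint_iff.mpr ⟨x, hxt, hxv⟩) with h | h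
        · exact (Finset.mem_sdiff.mp hy).2 (h (hlt.1 hy))
        · refine hvs ⟨h, fun h' => ?_⟩
          exact (Finset.mem_sdiff.mp hy).2 (h' (hlt.1 hy))
    · refine Finset.mem_filter.mpr ⟨hEcut u hE hne, fun t ht hlt => ?_⟩
      obtain ⟨s, hs, ⟨hvs, rfl⟩ | ⟨hvs, rfl⟩⟩ := (F.mem_cut_single hv t).mp ht
      · exact (Finset.mem_filter.mp hE).2 s hs
          (Finset.ssubset_of_ssubset_of_subset hlt Finset.sdiff_subset)
      · exact (Finset.mem_filter.mp hE).2 t hs hlt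

theorem XForest.sum_components_cut (F : XForest X) {v D : Finset X} (hv : v ∈ F.clusters)
    (hD : D ∈ F.components) (hvD : v ⊂ D) (f : Finset X → ℕ) :
    (∑ s ∈ (F.cut {v}).components, f s) + f D =
      (∑ s ∈ F.components, f s) + (f v + f (D \ v)) := by
  have hvne := F.nonempty_of_mem v hv
  have hDne : (D \ v).Nonempty := by rw [Finset.sdiff_nonempty]; exact hvD.2
  have h1 : D \ v ∉ F.components.erase D := by
    intro h
    obtain ⟨hne, h⟩ := Finset.mem_erase.mp h
    obtain ⟨y, hy⟩ := hDne
    exact hne (F.comp_eq h hD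
      (Finset.not_disjoint_iff.mpr ⟨y, hy, (Finset.mem_sdiff.mp hy).1⟩))
  have h2 : v ∉ insert (D \ v) (F.components.erase D) := by
    intro h
    obtain ⟨x, hx⟩ := hvne
    rcases Finset.mem_insert.mp h with h | h
    · have hx' := hx
      rw [h] at hx'
      exact (Finset.mem_sdiff.mp hx').2 hx
    · exact (Finset.mem_filter.mp (Finset.mem_erase.mp h).2).2 D (F.comp_mem hD) hvD
  rw [F.components_cut hv hD hvD, Finset.sum_insert h2, Finset.sum_insert h1,
    ← Finset.sum_erase_add _ _ hD]
  ring

/-- The number of components of `G` meeting the set `s`. -/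
def degIn (G : XForest X) (s : Finset X) : ℕ :=
  (G.components.filter fun C => ¬ Disjoint s C).card

/-- The number of nonempty intersections of a component of `F` and one of `G`. -/
def meetNum (F G : XForest X) : ℕ := ∑ s ∈ F.components, degIn G s

theorem meetNum_comm (F G : XForest X) : meetNum F G = meetNum G F := by
  have h := Finset.sum_card_bipartiteAbove_eq_sum_card_bipartiteBelow
    (s := F.components) (t := G.components) (fun s C : Finset X => ¬ Disjoint s C)
  unfold meetNum degIn
  refine Eq.trans ?_ (h.trans ?_)
  · rfl
  · refine Finset.sum_congr rfl fun C _ => ?_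
    unfold Finset.bipartiteBelow
    congr 1
    ext s
    simp only [Finset.mem_filter, disjoint_comm]

theorem degIn_pos (G : XForest X) {s : Finset X} (hs : s.Nonempty) : 1 ≤ degIn G s := by
  obtain ⟨x, hx⟩ := hs
  obtain ⟨C, hC, hxC⟩ := G.exists_comp_mem x
  exact Finset.card_pos.mpr
    ⟨C, Finset.mem_filter.mpr ⟨hC, Finset.not_disjoint_iff.mpr ⟨x, hx, hxC⟩⟩⟩

theorem ord_le_meetNum (F G : XForest X) : F.ord ≤ meetNum F G := by
  unfold XForest.ord meetNum
  rw [Finset.card_eq_sum_ones]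
  exact Finset.sum_le_sum fun s hs => degIn_pos G (F.nonempty_of_mem s (F.comp_mem hs))

theorem meetNum_of_labelIso (F G : XForest X) (h : LabelIso F G) : meetNum F G = F.ord := by
  unfold XForest.ord meetNum
  rw [Finset.card_eq_sum_ones]
  refine Finset.sum_congr rfl fun s hs => ?_
  unfold degIn
  rw [← (show F.components = G.components from h), Finset.card_eq_one]
  refine ⟨s, ?_⟩
  ext C
  rw [Finset.mem_filter, Finset.mem_singleton]
  constructor
  · rintro ⟨hC, hd⟩
    exact (F.comp_eq hs hC hd).symm
  · rintro rfl
    obtain ⟨x, hx⟩ := F.nonempty_of_mem C (F.comp_mem hs)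
    exact ⟨hs, Finset.not_disjoint_iff.mpr ⟨x, hx, hx⟩⟩

theorem degIn_split (G : XForest X) {v D : Finset X} :
    degIn G D ≤ degIn G v + degIn G (D \ v) := by
  unfold degIn
  refine le_trans (Finset.card_le_card ?_) (Finset.card_union_le _ _)
  intro C hC
  obtain ⟨hC, hd⟩ := Finset.mem_filter.mp hC
  obtain ⟨x, hx, hxC⟩ := Finset.not_disjoint_iff.mp hd
  rw [Finset.mem_union, Finset.mem_filter, Finset.mem_filter]
  by_cases hxv : x ∈ v
  · exact Or.inl ⟨hC, Finset.not_disjoint_iff.mpr ⟨x, hxv, hxC⟩⟩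
  · exact Or.inr ⟨hC, Finset.not_disjoint_iff.mpr ⟨x, Finset.mem_sdiff.mpr ⟨hx, hxv⟩, hxC⟩⟩

theorem degIn_split_strict (G : XForest X) {v D C : Finset X} (hC : C ∈ G.components)
    (h1 : ¬ Disjoint v C) (h2 : ¬ Disjoint (D \ v) C) :
    degIn G D + 1 ≤ degIn G v + degIn G (D \ v) := by
  unfold degIn
  rw [← Finset.card_union_add_card_inter]
  refine add_le_add (Finset.card_le_card ?_) (Finset.card_pos.mpr ⟨C, ?_⟩)
  · intro C hC
    obtain ⟨hC, hd⟩ := Finset.mem_filter.mp hC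
    obtain ⟨x, hx, hxC⟩ := Finset.not_disjoint_iff.mp hd
    rw [Finset.mem_union, Finset.mem_filter, Finset.mem_filter]
    by_cases hxv : x ∈ v
    · exact Or.inl ⟨hC, Finset.not_disjoint_iff.mpr ⟨x, hxv, hxC⟩⟩
    · exact Or.inr ⟨hC, Finset.not_disjoint_iff.mpr ⟨x, Finset.mem_sdiff.mpr ⟨hx, hxv⟩, hxC⟩⟩
  · rw [Finset.mem_inter, Finset.mem_filter, Finset.mem_filter]
    exact ⟨⟨hC, h1⟩, ⟨hC, h2⟩⟩

theorem meetNum_cut (F G : XForest X) {v D : Finset X} (hv : v ∈ F.clusters)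
    (hD : D ∈ F.components) (hvD : v ⊂ D) : meetNum F G ≤ meetNum (F.cut {v}) G := by
  have h1 := F.sum_components_cut hv hD hvD (degIn G)
  have h2 := degIn_split G (v := v) (D := D)
  unfold meetNum
  omega

theorem ord_cut (F : XForest X) {v D : Finset X} (hv : v ∈ F.clusters)
    (hD : D ∈ F.components) (hvD : v ⊂ D) : F.ord ≤ (F.cut {v}).ord := by
  have h1 := F.sum_components_cut hv hD hvD (fun _ => 1)
  unfold XForest.ord
  rw [Finset.card_eq_sum_ones, Finset.card_eq_sum_ones]
  omega

/-- If Reduction Rule 1 does not apply, cutting above a non-root vertex strictly increases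
the number of nonempty intersections. -/
theorem meetNum_cut_strict (F G : XForest X) {v D : Finset X} (hv : v ∈ F.clusters)
    (hD : D ∈ F.components) (hvD : v ⊂ D) (hno : ¬ RR1App G F v) :
    meetNum F G + 1 ≤ meetNum (F.cut {v}) G := by
  have h1 := F.sum_components_cut hv hD hvD (degIn G)
  have key : ∃ C ∈ G.components, ¬ Disjoint v C ∧ ¬ Disjoint (D \ v) C := by
    by_contra! hcon
    apply hno
    refine ⟨G.components.filter fun C => ¬ Disjoint v C, Finset.filter_subset _ _, ?_, D, hD, hv,
      hvD.1, ⟨D, F.comp_mem hD, hvD⟩, ?_⟩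
    · exact Finset.card_pos.mp (degIn_pos G (F.nonempty_of_mem v hv))
    · ext x
      rw [Finset.mem_inter, Finset.mem_biUnion]
      constructor
      · intro hx
        obtain ⟨C, hC, hxC⟩ := G.exists_comp_mem x
        exact ⟨hvD.1 hx, C, Finset.mem_filter.mpr
          ⟨hC, Finset.not_disjoint_iff.mpr ⟨x, hx, hxC⟩⟩, hxC⟩
      · rintro ⟨hxD, C, hC, hxC⟩
        obtain ⟨hC, hd⟩ := Finset.mem_filter.mp hC
        by_contra hxv
        exact Finset.disjoint_left.mp (hcon C hC hd)
          (Finset.mem_sdiff.mpr ⟨hxD, hxv⟩) hxC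
  obtain ⟨C, hC, ha, hb⟩ := key
  have h2 := degIn_split_strict G hC ha hb
  unfold meetNum
  omega

theorem rr1App_dest {Fi Fj : XForest X} {v : Finset X} (h : RR1App Fi Fj v) :
    v ∈ Fj.clusters ∧ ∃ D ∈ Fj.components, v ⊂ D := by
  obtain ⟨𝒞, -, -, C, hC, hv, hvC, ⟨t, ht, hvt⟩, -⟩ := h
  obtain ⟨D, hD, htD⟩ := Fj.exists_component ht
  exact ⟨hv, D, hD, Finset.ssubset_of_ssubset_of_subset hvt htD⟩

theorem rr1Step_meet {I I' : Inst X m} {p q : Fin m} (hpq : p ≠ q) (h : RR1Step I I') :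
    meetNum (I.F p) (I.F q) ≤ meetNum (I'.F p) (I'.F q) := by
  obtain ⟨i, j, -, v, hv, rfl⟩ := h
  obtain ⟨hv, D, hD, hvD⟩ := rr1App_dest hv
  by_cases hp : p = j
  · subst hp
    simp only [Function.update_self, Function.update_of_ne hpq.symm]
    exact meetNum_cut _ _ hv hD hvD
  · by_cases hq : q = j
    · subst hq
      simp only [Function.update_self, Function.update_of_ne hpq]
      rw [meetNum_comm, meetNum_comm (I.F p)]
      exact meetNum_cut _ _ hv hD hvD
    · simp only [Function.update_of_ne hp, Function.update_of_ne hq]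
      exact le_rfl

theorem rr1Step_ord {I I' : Inst X m} (p : Fin m) (h : RR1Step I I') :
    (I.F p).ord ≤ (I'.F p).ord := by
  obtain ⟨i, j, -, v, hv, rfl⟩ := h
  obtain ⟨hv, D, hD, hvD⟩ := rr1App_dest hv
  by_cases hp : p = j
  · subst hp
    simp only [Function.update_self]
    exact ord_cut _ hv hD hvD
  · simp only [Function.update_of_ne hp]
    exact le_rfl

theorem rr1Exhaust_meet {I I' : Inst X m} {p q : Fin m} (hpq : p ≠ q)
    (h : RR1Exhaust I I') : meetNum (I.F p) (I.F q) ≤ meetNum (I'.F p) (I'.F q) := by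
  obtain ⟨h, -⟩ := h
  induction h with
  | refl => exact le_rfl
  | tail _ hs ih => exact ih.trans (rr1Step_meet hpq hs)

theorem rr1Exhaust_ordMax {I I' : Inst X m} (h : RR1Exhaust I I') :
    I.ordMax ≤ I'.ordMax := by
  obtain ⟨h, -⟩ := h
  induction h with
  | refl => exact le_rfl
  | tail _ hs ih =>
    refine ih.trans (Finset.sup_mono_fun fun i _ => rr1Step_ord i hs)

theorem cut_step_meet {I : Inst X m} {p q i j : Fin m} {c v : Finset X} {k : ℤ}
    (hij : (i = p ∧ j = q) ∨ (i = q ∧ j = p)) (hne : i ≠ j)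
    (hno : ¬ RR1Applicable I) (hc : (I.F j).IsChild c v) :
    meetNum (I.F p) (I.F q) + 1 ≤
      meetNum ((⟨Function.update I.F j ((I.F j).cut {c}), k⟩ : Inst X m).F p)
        ((⟨Function.update I.F j ((I.F j).cut {c}), k⟩ : Inst X m).F q) := by
  obtain ⟨hcF, hvF, hcv, -⟩ := hc
  obtain ⟨D, hD, hvD⟩ := (I.F j).exists_component hvF
  have hcD := Finset.ssubset_of_ssubset_of_subset hcv hvD
  have hno' : ¬ RR1App (I.F i) (I.F j) c := fun h => hno ⟨i, j, hne, c, h⟩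
  have key := meetNum_cut_strict (I.F j) (I.F i) hcF hD hcD hno'
  rcases hij with ⟨rfl, rfl⟩ | ⟨rfl, rfl⟩
  · simp only [Function.update_self, Function.update_of_ne hne]
    rw [meetNum_comm, meetNum_comm (I.F i)]
    exact key
  · simp only [Function.update_self, Function.update_of_ne hne]
    exact key

theorem twoBRPath_meet {p q : Fin m} {I J : Inst X m} {n : ℕ} (hpq : p ≠ q)
    (h : TwoBRPath p q I J n) (hno : ¬ RR1Applicable I) :
    meetNum (I.F p) (I.F q) + n ≤ (J.F p).ord ∧ ¬ RR1Applicable J := by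
  induction h with
  | done I h => exact ⟨by rw [meetNum_of_labelIso _ _ h, add_zero], hno⟩
  | @step I I₁ I₂ J K I' n i j v c₁ c₂ hij hbr hpick hex hrest ih =>
    obtain ⟨ih1, ih2⟩ := ih hex.2
    refine ⟨?_, ih2⟩
    have h1 := rr1Exhaust_meet hpq hex
    obtain ⟨hne, ⟨C, -, hc1, hc2, -, -, -⟩, rfl, rfl⟩ := hbr
    rcases hpick with rfl | rfl
    · have h2 := cut_step_meet (k := cutk I j) hij hne hno hc1
      omega
    · have h2 := cut_step_meet (k := cutk I j) hij hne hno hc2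
      omega

theorem mbrAux_ordMax {I J : Inst X m} {n : ℕ} (h : MBRAux I J n)
    (hno : ¬ RR1Applicable I) : n + I.ordMax ≤ J.ordMax ∧ InstLabelIso J := by
  induction h with
  | done I h => exact ⟨by rw [zero_add], h⟩
  | @step I J I' a b s t hst hni h2 hrest ih =>
    obtain ⟨h3, h4⟩ := twoBRPath_meet hst.1 h2 hno
    obtain ⟨h5, h6⟩ := ih h4
    refine ⟨?_, h6⟩
    have h7 : I.ordMax ≤ (I.F s).ord := Finset.sup_le fun i _ => hst.2.1 i
    have h8 := ord_le_meetNum (I.F s) (I.F t)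
    have h9 : (J.F s).ord ≤ J.ordMax :=
      Finset.le_sup (f := fun i => (J.F i).ord) (Finset.mem_univ s)
    omega

end Helpers

/-- Corollary 3.5.  For any instance `(F_1^*, …, F_m^*; k^*)`
obtained by the m-BR-process on `(F_1, …, F_m; k)`, along which `|S_B|` edges
are removed by Branching Rule 1,
`Ord(F_1^*) ≥ |S_B| + Ord_max(F_1, …, F_m; k)`. -/
theorem statement_4 {X : Type*} [DecidableEq X] [Fintype X] {m : ℕ} (hm : 0 < m)
    (I I' : Inst X m) (n : ℕ)
    (hpath : MBRPath I I' n) :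
    n + I.ordMax ≤ (I'.F ⟨0, hm⟩).ord := by
  obtain ⟨J, hJ, hA⟩ := hpath
  obtain ⟨h1, h2⟩ := mbrAux_ordMax hA hJ.2
  have h3 := rr1Exhaust_ordMax hJ
  have h4 : I'.ordMax ≤ (I'.F ⟨0, hm⟩).ord := by
    refine Finset.sup_le fun i _ => ?_
    unfold XForest.ord
    rw [show (I'.F i).components = (I'.F ⟨0, hm⟩).components from h2 i ⟨0, hm⟩]
  omega
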